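/- Let T be a locally satisfiable negative local theory and C a local model of T. The following are equivalent: (i) C is an absolutely ultrahomogeneous model of T; (ii) C is a retractor of T; (iii) C is an absolutely saturated local positively closed model of T. -/

import Mathlib

noncomputable section

structure LocalLanguage : Type 1 where
  Sorts : Type
  Rel : (n : ℕ) → (Fin n → Sorts) → Type
  Const : Sorts → Type
  Loc : Sorts → Type
  locToRel : {s : Sorts} → Loc s → Rel 2 ![s, s]
  dd0 : (s : Sorts) → Loc s
  locMul : {s : Sorts} → Loc s → Loc s → Loc s
  locLe : {s : Sorts} → Loc s → Loc s → Prop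
  locMul_assoc : ∀ {s} (d₁ d₂ d₃ : Loc s), locMul (locMul d₁ d₂) d₃ = locMul d₁ (locMul d₂ d₃)
  dd0_locMul : ∀ {s} (d : Loc s), locMul (dd0 s) d = d
  locMul_dd0 : ∀ {s} (d : Loc s), locMul d (dd0 s) = d
  locLe_refl : ∀ {s} (d : Loc s), locLe d d
  locLe_trans : ∀ {s} (d₁ d₂ d₃ : Loc s), locLe d₁ d₂ → locLe d₂ d₃ → locLe d₁ d₃
  locLe_antisymm : ∀ {s} (d₁ d₂ : Loc s), locLe d₁ d₂ → locLe d₂ d₁ → d₁ = d₂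
  dd0_locLe : ∀ {s} (d : Loc s), locLe (dd0 s) d
  locMul_mono : ∀ {s} (d₁ d₂ e₁ e₂ : Loc s), locLe d₁ e₁ → locLe d₂ e₂ →
    locLe (locMul d₁ d₂) (locMul e₁ e₂)
  bound : {s : Sorts} → Const s → Const s → Loc s

structure LStructure (L : LocalLanguage) : Type 1 where
  Dom : L.Sorts → Type
  relMap : {n : ℕ} → {ρ : Fin n → L.Sorts} → L.Rel n ρ → ((i : Fin n) → Dom (ρ i)) → Prop
  constMap : {s : L.Sorts} → L.Const s → Dom s

def dpair {C : Fin 2 → Sort*} (a : C 0) (b : C 1) : (i : Fin 2) → C i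
  | ⟨0, _⟩ => a
  | ⟨1, _⟩ => b

def LStructure.locRel {L : LocalLanguage} (M : LStructure L) {s : L.Sorts}
    (d : L.Loc s) (a b : M.Dom s) : Prop :=
  M.relMap (L.locToRel d) (dpair a b)

structure IsLocal {L : LocalLanguage} (M : LStructure L) : Prop where
  symm : ∀ {s : L.Sorts} (d : L.Loc s) (a b : M.Dom s), M.locRel d a b → M.locRel d b a
  mono : ∀ {s : L.Sorts} (d₁ d₂ : L.Loc s), L.locLe d₁ d₂ →
    ∀ (a b : M.Dom s), M.locRel d₁ a b → M.locRel d₂ a b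
  comp : ∀ {s : L.Sorts} (d₁ d₂ : L.Loc s) (a b c : M.Dom s),
    M.locRel d₁ a b → M.locRel d₂ b c → M.locRel (L.locMul d₁ d₂) a c
  boundAx : ∀ {s : L.Sorts} (c₁ c₂ : L.Const s),
    M.locRel (L.bound c₁ c₂) (M.constMap c₁) (M.constMap c₂)
  total : ∀ {s : L.Sorts} (a b : M.Dom s), ∃ d : L.Loc s, M.locRel d a b
  dd0_eq : ∀ {s : L.Sorts} (a b : M.Dom s), M.locRel (L.dd0 s) a b ↔ a = b

/-! ## Syntax -/

/-- Terms: variables or constants (the language is relational). -/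
inductive LTerm (L : LocalLanguage) (α : Type) (σ : α → L.Sorts) : L.Sorts → Type
  | var (a : α) : LTerm L α σ (σ a)
  | const {s : L.Sorts} (c : L.Const s) : LTerm L α σ s

/-- Sort assignment for a context extended by one variable of sort `s`. -/
abbrev osort {L : LocalLanguage} {α : Type} (s : L.Sorts) (σ : α → L.Sorts) :
    Option α → L.Sorts :=
  fun o => Option.elim o s σ

/-- Positive formulas: atomic, conjunction, disjunction, existential quantification. -/
inductive PosForm (L : LocalLanguage) : (α : Type) → (α → L.Sorts) → Type 1
  | rel {α : Type} {σ : α → L.Sorts} {n : ℕ} {ρ : Fin n → L.Sorts}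
      (R : L.Rel n ρ) (ts : (i : Fin n) → LTerm L α σ (ρ i)) : PosForm L α σ
  | and {α : Type} {σ : α → L.Sorts} (φ ψ : PosForm L α σ) : PosForm L α σ
  | or {α : Type} {σ : α → L.Sorts} (φ ψ : PosForm L α σ) : PosForm L α σ
  | ex {α : Type} {σ : α → L.Sorts} (s : L.Sorts)
      (φ : PosForm L (Option α) (osort s σ)) : PosForm L α σ

/-- Local positive formulas: atomic, conjunction, disjunction, local existential
quantification `∃ x ∈ d(t) φ`. -/
inductive LPosForm (L : LocalLanguage) : (α : Type) → (α → L.Sorts) → Type 1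
  | rel {α : Type} {σ : α → L.Sorts} {n : ℕ} {ρ : Fin n → L.Sorts}
      (R : L.Rel n ρ) (ts : (i : Fin n) → LTerm L α σ (ρ i)) : LPosForm L α σ
  | and {α : Type} {σ : α → L.Sorts} (φ ψ : LPosForm L α σ) : LPosForm L α σ
  | or {α : Type} {σ : α → L.Sorts} (φ ψ : LPosForm L α σ) : LPosForm L α σ
  | lex {α : Type} {σ : α → L.Sorts} (s : L.Sorts) (d : L.Loc s) (t : LTerm L α σ s)
      (φ : LPosForm L (Option α) (osort s σ)) : LPosForm L α σ

/-- Local formulas: atomic, negation, conjunction, local existential quantification. -/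
inductive LForm (L : LocalLanguage) : (α : Type) → (α → L.Sorts) → Type 1
  | rel {α : Type} {σ : α → L.Sorts} {n : ℕ} {ρ : Fin n → L.Sorts}
      (R : L.Rel n ρ) (ts : (i : Fin n) → LTerm L α σ (ρ i)) : LForm L α σ
  | not {α : Type} {σ : α → L.Sorts} (φ : LForm L α σ) : LForm L α σ
  | and {α : Type} {σ : α → L.Sorts} (φ ψ : LForm L α σ) : LForm L α σ
  | lex {α : Type} {σ : α → L.Sorts} (s : L.Sorts) (d : L.Loc s) (t : LTerm L α σ s)
      (φ : LForm L (Option α) (osort s σ)) : LForm L α σ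

/-! ## Semantics -/

def LTerm.realize {L : LocalLanguage} (M : LStructure L) {α : Type} {σ : α → L.Sorts}
    (v : (a : α) → M.Dom (σ a)) : {s : L.Sorts} → LTerm L α σ s → M.Dom s
  | _, .var a => v a
  | _, .const c => M.constMap c

/-- Extension of a valuation by a value for the new variable. -/
def vcons {L : LocalLanguage} {M : LStructure L} {α : Type} {σ : α → L.Sorts} {s : L.Sorts}
    (x : M.Dom s) (v : (a : α) → M.Dom (σ a)) : (o : Option α) → M.Dom (osort s σ o)
  | none => x
  | some a => v a

def PosForm.Realize {L : LocalLanguage} (M : LStructure L) :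
    {α : Type} → {σ : α → L.Sorts} → PosForm L α σ → ((a : α) → M.Dom (σ a)) → Prop
  | _, _, .rel R ts, v => M.relMap R (fun i => (ts i).realize M v)
  | _, _, .and φ ψ, v => φ.Realize M v ∧ ψ.Realize M v
  | _, _, .or φ ψ, v => φ.Realize M v ∨ ψ.Realize M v
  | _, _, .ex s φ, v => ∃ x : M.Dom s, φ.Realize M (vcons x v)

def LPosForm.Realize {L : LocalLanguage} (M : LStructure L) :
    {α : Type} → {σ : α → L.Sorts} → LPosForm L α σ → ((a : α) → M.Dom (σ a)) → Prop
  | _, _, .rel R ts, v => M.relMap R (fun i => (ts i).realize M v)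
  | _, _, .and φ ψ, v => φ.Realize M v ∧ ψ.Realize M v
  | _, _, .or φ ψ, v => φ.Realize M v ∨ ψ.Realize M v
  | _, _, .lex s d t φ, v =>
      ∃ x : M.Dom s, M.locRel d x (t.realize M v) ∧ φ.Realize M (vcons x v)

def LForm.Realize {L : LocalLanguage} (M : LStructure L) :
    {α : Type} → {σ : α → L.Sorts} → LForm L α σ → ((a : α) → M.Dom (σ a)) → Prop
  | _, _, .rel R ts, v => M.relMap R (fun i => (ts i).realize M v)
  | _, _, .not φ, v => ¬ φ.Realize M v
  | _, _, .and φ ψ, v => φ.Realize M v ∧ ψ.Realize M v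
  | _, _, .lex s d t φ, v =>
      ∃ x : M.Dom s, M.locRel d x (t.realize M v) ∧ φ.Realize M (vcons x v)

/-- Quantifier-free positive formulas. -/
inductive PosForm.IsQF {L : LocalLanguage} : {α : Type} → {σ : α → L.Sorts} → PosForm L α σ → Prop
  | rel {α : Type} {σ : α → L.Sorts} {n : ℕ} {ρ : Fin n → L.Sorts}
      (R : L.Rel n ρ) (ts : (i : Fin n) → LTerm L α σ (ρ i)) : PosForm.IsQF (.rel R ts)
  | and {α : Type} {σ : α → L.Sorts} {φ ψ : PosForm L α σ} :
      PosForm.IsQF φ → PosForm.IsQF ψ → PosForm.IsQF (.and φ ψ)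
  | or {α : Type} {σ : α → L.Sorts} {φ ψ : PosForm L α σ} :
      PosForm.IsQF φ → PosForm.IsQF ψ → PosForm.IsQF (.or φ ψ)


/-! ## Sentences, theories, models -/

/-- Sort assignment for the empty context. -/
abbrev emptySorts (L : LocalLanguage) : Empty → L.Sorts := fun e => e.elim

/-- Positive sentences. -/
abbrev PosSentence (L : LocalLanguage) := PosForm L Empty (emptySorts L)

/-- A positive sentence holds in a structure. -/
def PosSentence.RealizedIn {L : LocalLanguage} (φ : PosSentence L) (M : LStructure L) : Prop :=
  φ.Realize M (fun e => e.elim)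

/-- We represent a negative theory by the set of positive sentences whose negations
belong to it.  `M` is a local model of `T` if `M` is local and satisfies the negation of
every positive sentence in `T`. -/
def LocalModel {L : LocalLanguage} (M : LStructure L) (T : Set (PosSentence L)) : Prop :=
  IsLocal M ∧ ∀ φ ∈ T, ¬ φ.RealizedIn M

/-- `T` (a set of positive sentences standing for the negative theory `{¬φ : φ ∈ T}`)
is a negative local theory if it is closed under local implication: any negative sentence
true in every local model of `T` is already in `T`. -/
def IsNegLocalTheory {L : LocalLanguage} (T : Set (PosSentence L)) : Prop :=
  ∀ φ : PosSentence L, (∀ M : LStructure L, LocalModel M T → ¬ φ.RealizedIn M) → φ ∈ T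

/-- `T` is locally satisfiable: it has a local model. -/
def LocSat {L : LocalLanguage} (T : Set (PosSentence L)) : Prop :=
  ∃ M : LStructure L, LocalModel M T

/-- The negative theory of a structure (as the set of positive sentences failing in it). -/
def ThNeg {L : LocalLanguage} (M : LStructure L) : Set (PosSentence L) :=
  {φ | ¬ φ.RealizedIn M}

/-! ## Homomorphisms -/

structure LHom {L : LocalLanguage} (M N : LStructure L) where
  toFun : (s : L.Sorts) → M.Dom s → N.Dom s
  map_rel : ∀ {n : ℕ} {ρ : Fin n → L.Sorts} (R : L.Rel n ρ) (x : (i : Fin n) → M.Dom (ρ i)),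
    M.relMap R x → N.relMap R (fun i => toFun (ρ i) (x i))
  map_const : ∀ {s : L.Sorts} (c : L.Const s), toFun s (M.constMap c) = N.constMap c

def LHom.comp {L : LocalLanguage} {M N P : LStructure L} (g : LHom N P) (f : LHom M N) :
    LHom M P where
  toFun s := g.toFun s ∘ f.toFun s
  map_rel R x h := g.map_rel R _ (f.map_rel R x h)
  map_const c := by
    simp only [Function.comp_apply, f.map_const, g.map_const]

def LHom.id {L : LocalLanguage} (M : LStructure L) : LHom M M where
  toFun _ := fun x => x
  map_rel _ _ h := h
  map_const _ := rfl

/-- A homomorphism is a positive embedding if it reflects all positive formulas. -/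
def LHom.IsPosEmbedding {L : LocalLanguage} {M N : LStructure L} (h : LHom M N) : Prop :=
  ∀ (α : Type) (σ : α → L.Sorts) (φ : PosForm L α σ) (v : (a : α) → M.Dom (σ a)),
    φ.Realize N (fun a => h.toFun (σ a) (v a)) → φ.Realize M v

/-- A local positively closed model of `T`. -/
def IsPC {L : LocalLanguage} (M : LStructure L) (T : Set (PosSentence L)) : Prop :=
  LocalModel M T ∧
    ∀ (N : LStructure L) (h : LHom M N), LocalModel N T → h.IsPosEmbedding

/-- An endomorphism is an automorphism if it has a two-sided inverse homomorphism. -/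
def LHom.IsAuto {L : LocalLanguage} {M : LStructure L} (f : LHom M M) : Prop :=
  ∃ g : LHom M M, g.comp f = LHom.id M ∧ f.comp g = LHom.id M

/-- Isomorphism of structures. -/
def Isomorphic {L : LocalLanguage} (M N : LStructure L) : Prop :=
  ∃ (f : LHom M N) (g : LHom N M), g.comp f = LHom.id M ∧ f.comp g = LHom.id N

/-! ## Types -/

/-- The local positive type of a tuple. -/
def ltp {L : LocalLanguage} (M : LStructure L) {α : Type} {σ : α → L.Sorts}
    (v : (a : α) → M.Dom (σ a)) : Set (LPosForm L α σ) :=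
  {φ | φ.Realize M v}

/-- The positive type of a tuple. -/
def ptp {L : LocalLanguage} (M : LStructure L) {α : Type} {σ : α → L.Sorts}
    (v : (a : α) → M.Dom (σ a)) : Set (PosForm L α σ) :=
  {φ | φ.Realize M v}

/-- A partial local positive type of `T` on `(α, σ)`: a set of local positive formulas
realized by some tuple in some local model of `T`. -/
def IsPartialLType {L : LocalLanguage} (T : Set (PosSentence L)) {α : Type}
    {σ : α → L.Sorts} (Γ : Set (LPosForm L α σ)) : Prop :=
  ∃ (M : LStructure L) (v : (a : α) → M.Dom (σ a)),
    LocalModel M T ∧ ∀ φ ∈ Γ, LPosForm.Realize M φ v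

/-- A local positive type: a maximal partial local positive type. -/
def IsLType {L : LocalLanguage} (T : Set (PosSentence L)) {α : Type}
    {σ : α → L.Sorts} (Γ : Set (LPosForm L α σ)) : Prop :=
  IsPartialLType T Γ ∧ ∀ Γ' : Set (LPosForm L α σ), IsPartialLType T Γ' → Γ ⊆ Γ' → Γ' = Γ

/-- A variable `(α, σ)` is pointed if every sort not occurring among its sorts carries a
constant symbol. -/
def VPointed {L : LocalLanguage} {α : Type} (σ : α → L.Sorts) : Prop :=
  ∀ s : L.Sorts, s ∉ Set.range σ → Nonempty (L.Const s)


/-! ## Bounds and bounded satisfiability -/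

/-- Pair of terms as arguments for a binary relation symbol. -/
def tpair {L : LocalLanguage} {α : Type} {σ : α → L.Sorts} {s t : L.Sorts}
    (t₁ : LTerm L α σ s) (t₂ : LTerm L α σ t) : (i : Fin 2) → LTerm L α σ (![s, t] i) :=
  dpair t₁ t₂

/-- A bound of the variable `(α, σ)`: a choice, for every single variable whose sort
carries a constant symbol, of a locality relation and a constant, and for every pair of
single variables of the same sort, of a locality relation. -/
structure VBound (L : LocalLanguage) (α : Type) (σ : α → L.Sorts) where
  dConst : (a : α) → Nonempty (L.Const (σ a)) → L.Loc (σ a)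
  cConst : (a : α) → Nonempty (L.Const (σ a)) → L.Const (σ a)
  dPair : (a b : α) → σ a = σ b → L.Loc (σ a)

/-- The set of (atomic, quantifier-free) local positive formulas making up a bound:
`d_a(x_a, c_a)` and `d_{a,b}(x_a, x_b)`. -/
def VBound.toSet {L : LocalLanguage} {α : Type} {σ : α → L.Sorts} (B : VBound L α σ) :
    Set (LPosForm L α σ) :=
  {φ | (∃ (a : α) (h : Nonempty (L.Const (σ a))),
          φ = LPosForm.rel (L.locToRel (B.dConst a h))
                (tpair (LTerm.var a) (LTerm.const (B.cConst a h)))) ∨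
       (∃ (a b : α) (e : σ a = σ b),
          φ = LPosForm.rel (L.locToRel (B.dPair a b e))
                (tpair (LTerm.var a) (e.symm ▸ LTerm.var b)))}

/-- A bound holds of a tuple if all its formulas do. -/
def VBound.Holds {L : LocalLanguage} {α : Type} {σ : α → L.Sorts} (B : VBound L α σ)
    (M : LStructure L) (v : (a : α) → M.Dom (σ a)) : Prop :=
  ∀ ψ ∈ B.toSet, LPosForm.Realize M ψ v

/-- Finite local satisfiability of a set of local positive formulas in `T`. -/
def FinLocSat {L : LocalLanguage} (T : Set (PosSentence L)) {α : Type} {σ : α → L.Sorts}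
    (Δ : Set (LPosForm L α σ)) : Prop :=
  ∀ Δ₀ ⊆ Δ, Δ₀.Finite →
    ∃ (M : LStructure L) (v : (a : α) → M.Dom (σ a)),
      LocalModel M T ∧ ∀ φ ∈ Δ₀, LPosForm.Realize M φ v

/-- Bounded satisfiability: for some bound `B`, `Γ ∪ B` is finitely locally satisfiable. -/
def BoundedlySat {L : LocalLanguage} (T : Set (PosSentence L)) {α : Type}
    {σ : α → L.Sorts} (Γ : Set (LPosForm L α σ)) : Prop :=
  ∃ B : VBound L α σ, FinLocSat T (Γ ∪ B.toSet)

/-! ## Π₁-local formulas -/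

/-- Dependent `Sum.elim` of valuations. -/
def sval {L : LocalLanguage} {M : LStructure L} {α β : Type} {σ : α → L.Sorts}
    {τ : β → L.Sorts} (v : (a : α) → M.Dom (σ a)) (w : (b : β) → M.Dom (τ b)) :
    (x : α ⊕ β) → M.Dom (Sum.elim σ τ x)
  | .inl a => v a
  | .inr b => w b

/-- A Π₁-local formula: a universally quantified local formula. -/
structure Pi1LForm (L : LocalLanguage) (α : Type) (σ : α → L.Sorts) : Type 1 where
  n : ℕ
  τ : Fin n → L.Sorts
  matrix : LForm L (α ⊕ Fin n) (Sum.elim σ τ)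

def Pi1LForm.Realize {L : LocalLanguage} {α : Type} {σ : α → L.Sorts}
    (φ : Pi1LForm L α σ) (M : LStructure L) (v : (a : α) → M.Dom (σ a)) : Prop :=
  ∀ w : (i : Fin φ.n) → M.Dom (φ.τ i), φ.matrix.Realize M (sval v w)

/-- Bounded satisfiability of a set of Π₁-local formulas: for some bound `B`, every
finite subset of `Γ` together with every finite part of `B` is realized in a local
model of `T`. -/
def Pi1BoundedlySat {L : LocalLanguage} (T : Set (PosSentence L)) {α : Type}
    {σ : α → L.Sorts} (Γ : Set (Pi1LForm L α σ)) : Prop :=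
  ∃ B : VBound L α σ,
    ∀ Γ₀ ⊆ Γ, Γ₀.Finite → ∀ F ⊆ B.toSet, F.Finite →
      ∃ (M : LStructure L) (v : (a : α) → M.Dom (σ a)),
        LocalModel M T ∧ (∀ φ ∈ Γ₀, Pi1LForm.Realize φ M v) ∧
          (∀ ψ ∈ F, LPosForm.Realize M ψ v)

/-! ## Cardinality, homogeneity, retractors -/

/-- The cardinality of a structure: that of the disjoint union of its sorts. -/
def LStructure.card {L : LocalLanguage} (M : LStructure L) : Cardinal :=
  Cardinal.mk (Σ s : L.Sorts, M.Dom s)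

/-- The cardinality of a local language. -/
def LocalLanguage.card (L : LocalLanguage) : Cardinal :=
  max Cardinal.aleph0
    (Cardinal.mk (L.Sorts ⊕ (Σ s : L.Sorts, L.Const s) ⊕ (Σ s : L.Sorts, L.Loc s) ⊕
      (Σ (n : ℕ) (ρ : Fin n → L.Sorts), L.Rel n ρ)))

/-- `M` is a (local positively) κ-ultrahomogeneous model of `T`. -/
def IsUltrahomogeneous {L : LocalLanguage} (T : Set (PosSentence L)) (M : LStructure L)
    (κ : Cardinal) : Prop :=
  ∀ A B : LStructure L, LocalModel A T → LocalModel B T → A.card < κ → B.card < κ →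
    ∀ f : LHom A M, f.IsPosEmbedding → ∀ g : LHom A B, ∃ h : LHom B M, h.comp g = f

/-- A retractor of `T`: a local model of `T` such that every homomorphism into a local
model of `T` has a retraction. -/
def IsRetractor {L : LocalLanguage} (T : Set (PosSentence L)) (C : LStructure L) : Prop :=
  LocalModel C T ∧
    ∀ N : LStructure L, LocalModel N T →
      ∀ f : LHom C N, ∃ g : LHom N C, g.comp f = LHom.id C

/-- `M` is κ-universal for a class `K` of structures. -/
def IsUniversal {L : LocalLanguage} (M : LStructure L) (K : LStructure L → Prop)
    (κ : Cardinal) : Prop :=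
  ∀ N : LStructure L, K N → N.card < κ → Nonempty (LHom N M)

/-- `M` is absolutely universal for a class `K` of structures. -/
def IsAbsUniversal {L : LocalLanguage} (M : LStructure L) (K : LStructure L → Prop) : Prop :=
  ∀ N : LStructure L, K N → Nonempty (LHom N M)

/-- Compatibility of two local models of `T`. -/
def Compat {L : LocalLanguage} (T : Set (PosSentence L)) (A B : LStructure L) : Prop :=
  ∃ M : LStructure L, LocalModel M T ∧ Nonempty (LHom A M) ∧ Nonempty (LHom B M)

/-- The local joint (homomorphism) property. -/
def HasLJP {L : LocalLanguage} (T : Set (PosSentence L)) : Prop :=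
  ∀ A B : LStructure L, LocalModel A T → LocalModel B T →
    ∃ M : LStructure L, LocalModel M T ∧ Nonempty (LHom A M) ∧ Nonempty (LHom B M)


/-! ## Parameters -/

/-- A set of parameters in a structure. -/
def ParamSet {L : LocalLanguage} (M : LStructure L) := (s : L.Sorts) → Set (M.Dom s)

/-- Interpretation in `M` of old and new constants of the expanded language. -/
def paramInterp {L : LocalLanguage} (M : LStructure L) (A : ParamSet M) {s : L.Sorts} :
    L.Const s ⊕ (A s) → M.Dom s
  | .inl c => M.constMap c
  | .inr a => a.1

/-- The expansion `L(A)` of `L` by new constants for the parameters `A` of a local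
structure `M`; bounds for pairs involving the new constants are chosen (by locality
axiom (A5)) so that they hold in `M`. -/
noncomputable def LocalLanguage.withParams (L : LocalLanguage) (M : LStructure L)
    (hM : IsLocal M) (A : ParamSet M) : LocalLanguage where
  Sorts := L.Sorts
  Rel := L.Rel
  Const s := L.Const s ⊕ (A s)
  Loc := L.Loc
  locToRel := L.locToRel
  dd0 := L.dd0
  locMul := L.locMul
  locLe := L.locLe
  locMul_assoc := L.locMul_assoc
  dd0_locMul := L.dd0_locMul
  locMul_dd0 := L.locMul_dd0
  locLe_refl := L.locLe_refl
  locLe_trans := L.locLe_trans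
  locLe_antisymm := L.locLe_antisymm
  dd0_locLe := L.dd0_locLe
  locMul_mono := L.locMul_mono
  bound := fun {_s} c₁ c₂ =>
    match c₁, c₂ with
    | .inl c₁, .inl c₂ => L.bound c₁ c₂
    | c₁, c₂ => Classical.choose (hM.total (paramInterp M A c₁) (paramInterp M A c₂))

/-- The natural expansion `M_A` of `M` to an `L(A)`-structure. -/
noncomputable def LStructure.withParams {L : LocalLanguage} (M : LStructure L)
    (hM : IsLocal M) (A : ParamSet M) : LStructure (L.withParams M hM A) where
  Dom := M.Dom
  relMap := M.relMap
  constMap := paramInterp M A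

/-- `M` has the local joint property over `A`: any two local models of `Th₋(M/A)` map
into a common local model of `Th₋(M/A)`. -/
def HasLJPOver {L : LocalLanguage} (M : LStructure L) (hM : IsLocal M) (A : ParamSet M) :
    Prop :=
  HasLJP (ThNeg (M.withParams hM A))

/-- `M` is (local positively) κ-saturated: it realizes every local positive type of
`Th₋(M/A)` on `x` whenever `|x| < κ`, `|A| < κ` and `M` has the local joint property
over `A`. -/
def IsSaturatedAt {L : LocalLanguage} (M : LStructure L) (hM : IsLocal M)
    (κ : Cardinal) : Prop :=
  ∀ A : ParamSet M, Cardinal.mk (Σ s : L.Sorts, A s) < κ → HasLJPOver M hM A →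
    ∀ (α : Type) (σ : α → L.Sorts), Cardinal.mk α < κ →
      ∀ Γ : Set (LPosForm (L.withParams M hM A) α σ),
        IsLType (ThNeg (M.withParams hM A)) Γ →
          ∃ v : (a : α) → M.Dom (σ a), ∀ φ ∈ Γ, LPosForm.Realize (M.withParams hM A) φ v

/-- The local positive type of a tuple over a set of parameters `A`, rendered as the set
of local positive formulas with extra free variables for the parameters of `A` that are
satisfied when those variables are evaluated at the parameters themselves. -/
def ltpOver {L : LocalLanguage} (M : LStructure L) (A : ParamSet M) {α : Type}
    {σ : α → L.Sorts} (v : (a : α) → M.Dom (σ a)) :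
    Set (LPosForm L (α ⊕ Σ s : L.Sorts, A s) (Sum.elim σ (fun p => p.1))) :=
  {φ | φ.Realize M (sval v (fun p => p.2.1))}

/-! ## Substructures -/

/-- A substructure of `M`: a family of subsets closed under the constants (the language
is relational). -/
structure Substruct {L : LocalLanguage} (M : LStructure L) where
  carrier : (s : L.Sorts) → Set (M.Dom s)
  const_mem : ∀ {s : L.Sorts} (c : L.Const s), M.constMap c ∈ carrier s

/-- The induced structure on a substructure. -/
def Substruct.toStruct {L : LocalLanguage} {M : LStructure L} (A : Substruct M) :
    LStructure L where
  Dom s := A.carrier s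
  relMap R x := M.relMap R (fun i => (x i).1)
  constMap c := ⟨M.constMap c, A.const_mem c⟩


/-! ## Topologies -/

/-- The `d`-ball at `a`. -/
def LStructure.ball {L : LocalLanguage} (M : LStructure L) {s : L.Sorts} (d : L.Loc s)
    (a : M.Dom s) : Set (M.Dom s) :=
  {b | M.locRel d a b}

/-- The local positive logic topology on a single sort of `M`: closed sets are the
subsets defined by sets of local positive formulas with parameters in `M` (parameters
being rendered as extra free variables evaluated at themselves). -/
def lpTopologyS {L : LocalLanguage} (M : LStructure L) (s : L.Sorts) :
    TopologicalSpace (M.Dom s) :=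
  TopologicalSpace.generateFrom
    {U | ∃ φ : LPosForm L (Unit ⊕ Σ s' : L.Sorts, M.Dom s')
            (Sum.elim (fun _ => s) (fun p => p.1)),
      U = {x | ¬ LPosForm.Realize M φ (sval (fun _ => x) (fun p => p.2))}}

/-- The space of local positive types of `T` on the variable `(α, σ)`. -/
def LTypeSpace (L : LocalLanguage) (T : Set (PosSentence L)) (α : Type)
    (σ : α → L.Sorts) :=
  {Γ : Set (LPosForm L α σ) // IsLType T Γ}

/-- The local positive logic topology on the space of local positive types: generated by
declaring `⟨φ⟩ = {p : φ ∈ p}` closed for every local positive formula `φ`; its closed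
sets are then exactly the sets `⟨Γ⟩` together with `∅`. -/
instance {L : LocalLanguage} (T : Set (PosSentence L)) (α : Type) (σ : α → L.Sorts) :
    TopologicalSpace (LTypeSpace L T α σ) :=
  TopologicalSpace.generateFrom
    {U | ∃ φ : LPosForm L α σ, U = {p : LTypeSpace L T α σ | φ ∉ p.1}}

/-! ## Completeness and compactness -/

/-- `T` is complete: `T = Th₋(M)` for every local positively closed model `M` of `T`. -/
def IsCompleteTheory {L : LocalLanguage} (T : Set (PosSentence L)) : Prop :=
  ∀ M : LStructure L, IsPC M T → ThNeg M = T

/-- `T` is local positively compact. -/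
def IsLocPosCompact {L : LocalLanguage} (T : Set (PosSentence L)) : Prop :=
  ∀ (s : L.Sorts) (γ : Type), Finite γ →
    ∀ (τ : γ → L.Sorts) (φ : LPosForm L (Fin 2 ⊕ γ) (Sum.elim (fun _ => s) τ)),
      (∀ M : LStructure L, LocalModel M T →
        ∀ (a : M.Dom s) (w : (j : γ) → M.Dom (τ j)),
          ¬ LPosForm.Realize M φ (sval ![a, a] w)) →
      ∀ (B : VBound L (Unit ⊕ γ) (Sum.elim (fun _ => s) τ)) (d : L.Loc s),
        ∃ k : ℕ, 0 < k ∧ ∀ M : LStructure L, LocalModel M T →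
          ¬ ∃ (a : Fin k → M.Dom s) (w : (j : γ) → M.Dom (τ j)),
            ∀ i j : Fin k, i ≠ j →
              B.Holds M (sval (fun _ => a i) w) ∧ M.locRel d (a i) (a j) ∧
                LPosForm.Realize M φ (sval ![a i, a j] w)

/-! ## Substitution and change of language -/

def LTerm.weaken {L : LocalLanguage} {α : Type} {σ : α → L.Sorts} (s' : L.Sorts) :
    {s : L.Sorts} → LTerm L α σ s → LTerm L (Option α) (osort s' σ) s
  | _, .var a => LTerm.var (σ := osort s' σ) (some a)
  | _, .const c => .const c

theorem LTerm.realize_weaken {L : LocalLanguage} (M : LStructure L) {α : Type}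
    {σ : α → L.Sorts} {s s' : L.Sorts} (t : LTerm L α σ s) (x : M.Dom s')
    (v : (a : α) → M.Dom (σ a)) :
    (t.weaken s').realize M (vcons x v) = t.realize M v := by
  cases t <;> rfl

/-- Simultaneous substitution of terms for the variables and the constants of a term. -/
def LTerm.translate {L L' : LocalLanguage} (ι : L.Sorts → L'.Sorts)
    {α β : Type} {σ : α → L.Sorts} {τ : β → L'.Sorts}
    (t : (a : α) → LTerm L' β τ (ι (σ a)))
    (k : (s : L.Sorts) → L.Const s → LTerm L' β τ (ι s)) :
    {s : L.Sorts} → LTerm L α σ s → LTerm L' β τ (ι s)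
  | _, .var a => t a
  | _, .const c => k _ c

theorem LTerm.realize_translate {L L' : LocalLanguage} (ι : L.Sorts → L'.Sorts)
    (M : LStructure L') (κ : {s : L.Sorts} → L.Const s → M.Dom (ι s))
    {r : {n : ℕ} → {ρ : Fin n → L.Sorts} → L.Rel n ρ → ((i : Fin n) → M.Dom (ι (ρ i))) → Prop}
    {α β : Type} {σ : α → L.Sorts} {τ : β → L'.Sorts} {s : L.Sorts} (u : LTerm L α σ s)
    (t : (a : α) → LTerm L' β τ (ι (σ a)))
    (k : (s : L.Sorts) → L.Const s → LTerm L' β τ (ι s)) (v : (b : β) → M.Dom (τ b))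
    (hk : ∀ s c, (k s c).realize M v = κ c) :
    (u.translate ι t k).realize M v =
      u.realize (⟨fun s => M.Dom (ι s), r, κ⟩ : LStructure L) (fun a => (t a).realize M v) := by
  cases u with
  | var a => rfl
  | const c => exact hk _ c

def liftTerms {L L' : LocalLanguage} (ι : L.Sorts → L'.Sorts)
    {α β : Type} {σ : α → L.Sorts} {τ : β → L'.Sorts} (s : L.Sorts)
    (t : (a : α) → LTerm L' β τ (ι (σ a))) :
    (o : Option α) → LTerm L' (Option β) (osort (ι s) τ) (ι (osort s σ o))
  | none => LTerm.var (σ := osort (ι s) τ) none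
  | some a => (t a).weaken (ι s)

/-- Translation of positive formulas along a map of sorts and relation symbols, substituting
terms for the variables and the constants. -/
def PosForm.translate {L L' : LocalLanguage} (ι : L.Sorts → L'.Sorts)
    (ιR : {n : ℕ} → {ρ : Fin n → L.Sorts} → L.Rel n ρ → L'.Rel n (fun i => ι (ρ i))) :
    {α : Type} → {σ : α → L.Sorts} → PosForm L α σ → {β : Type} → {τ : β → L'.Sorts} →
    ((a : α) → LTerm L' β τ (ι (σ a))) →
    ((s : L.Sorts) → L.Const s → LTerm L' β τ (ι s)) → PosForm L' β τ
  | _, _, .rel R ts, _, _, t, k => .rel (ιR R) (fun i => (ts i).translate ι t k)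
  | _, _, .and φ ψ, _, _, t, k => .and (φ.translate ι ιR t k) (ψ.translate ι ιR t k)
  | _, _, .or φ ψ, _, _, t, k => .or (φ.translate ι ιR t k) (ψ.translate ι ιR t k)
  | _, _, .ex s φ, _, _, t, k =>
      .ex (ι s) (φ.translate ι ιR (liftTerms ι s t) (fun s' c => (k s' c).weaken (ι s)))

theorem PosForm.realize_translate {L L' : LocalLanguage} (ι : L.Sorts → L'.Sorts)
    (ιR : {n : ℕ} → {ρ : Fin n → L.Sorts} → L.Rel n ρ → L'.Rel n (fun i => ι (ρ i)))
    (M : LStructure L') (κ : {s : L.Sorts} → L.Const s → M.Dom (ι s))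
    {α : Type} {σ : α → L.Sorts} (φ : PosForm L α σ) :
    ∀ {β : Type} {τ : β → L'.Sorts} (t : (a : α) → LTerm L' β τ (ι (σ a)))
      (k : (s : L.Sorts) → L.Const s → LTerm L' β τ (ι s)) (v : (b : β) → M.Dom (τ b)),
      (∀ s c, (k s c).realize M v = κ c) →
      ((φ.translate ι ιR t k).Realize M v ↔
        φ.Realize (⟨fun s => M.Dom (ι s), fun R x => M.relMap (ιR R) x, κ⟩ : LStructure L)
          (fun a => (t a).realize M v)) := by
  induction φ with
  | rel R ts =>
    intro β τ t k v hk
    simp only [PosForm.translate, PosForm.Realize]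
    refine iff_of_eq (congrArg _ (funext fun i => ?_))
    exact LTerm.realize_translate ι M κ (ts i) t k v hk
  | and φ ψ ih₁ ih₂ =>
    intro β τ t k v hk
    exact and_congr (ih₁ t k v hk) (ih₂ t k v hk)
  | or φ ψ ih₁ ih₂ =>
    intro β τ t k v hk
    exact or_congr (ih₁ t k v hk) (ih₂ t k v hk)
  | ex s φ ih =>
    intro β τ t k v hk
    refine exists_congr fun x => ?_
    refine (ih _ _ _ fun s' c => (LTerm.realize_weaken M _ x v).trans (hk s' c)).trans ?_
    refine iff_of_eq (congrArg _ (funext fun o => ?_))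
    cases o with
    | none => rfl
    | some a => exact LTerm.realize_weaken M _ x v

/-- Substitution of terms for variables. -/
def PosForm.subst {L : LocalLanguage} {α β : Type} {σ : α → L.Sorts} {τ : β → L.Sorts}
    (φ : PosForm L α σ) (t : (a : α) → LTerm L β τ (σ a)) : PosForm L β τ :=
  φ.translate (fun s => s) (fun R => R) t (fun _ c => .const c)

theorem PosForm.realize_subst {L : LocalLanguage} {α β : Type} {σ : α → L.Sorts}
    {τ : β → L.Sorts} (φ : PosForm L α σ) (t : (a : α) → LTerm L β τ (σ a))
    (M : LStructure L) (v : (b : β) → M.Dom (τ b)) :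
    (φ.subst t).Realize M v ↔ φ.Realize M (fun a => (t a).realize M v) :=
  φ.realize_translate (fun s => s) (fun R => R) M M.constMap t _ v (fun _ _ => rfl)

/-! ## Existential closure -/

theorem PosForm.exists_finite_support {L : LocalLanguage} {α : Type} {σ : α → L.Sorts}
    (φ : PosForm L α σ) :
    ∃ S : Finset α, ∀ (M : LStructure L) (v w : (a : α) → M.Dom (σ a)),
      (∀ a ∈ S, v a = w a) → φ.Realize M v → φ.Realize M w := by
  classical
  induction φ with
  | @rel α σ n ρ R ts =>
    have key : ∀ {s : L.Sorts} (t : LTerm L α σ s), ∃ S : Finset α,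
        ∀ (M : LStructure L) (v w : (a : α) → M.Dom (σ a)),
          (∀ a ∈ S, v a = w a) → t.realize M v = t.realize M w := by
      intro s t
      cases t with
      | var a => exact ⟨{a}, fun M v w h => h a (by simp)⟩
      | const c => exact ⟨∅, fun M v w h => rfl⟩
    choose S hS using fun i => key (ts i)
    refine ⟨Finset.univ.biUnion S, fun M v w h hv => ?_⟩
    have : (fun i => (ts i).realize M v) = fun i => (ts i).realize M w :=
      funext fun i => hS i M v w fun a ha => h a (Finset.mem_biUnion.2 ⟨i, by simp, ha⟩)
    simpa only [PosForm.Realize, this] using hv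
  | and φ ψ ih₁ ih₂ =>
    obtain ⟨S₁, h₁⟩ := ih₁
    obtain ⟨S₂, h₂⟩ := ih₂
    exact ⟨S₁ ∪ S₂, fun M v w h hv =>
      ⟨h₁ M v w (fun a ha => h a (Finset.mem_union_left _ ha)) hv.1,
        h₂ M v w (fun a ha => h a (Finset.mem_union_right _ ha)) hv.2⟩⟩
  | or φ ψ ih₁ ih₂ =>
    obtain ⟨S₁, h₁⟩ := ih₁
    obtain ⟨S₂, h₂⟩ := ih₂
    exact ⟨S₁ ∪ S₂, fun M v w h hv => hv.imp
      (h₁ M v w fun a ha => h a (Finset.mem_union_left _ ha))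
      (h₂ M v w fun a ha => h a (Finset.mem_union_right _ ha))⟩
  | ex s φ ih =>
    obtain ⟨S, hS⟩ := ih
    refine ⟨S.eraseNone, fun M v w h => ?_⟩
    rintro ⟨x, hx⟩
    refine ⟨x, hS M _ _ ?_ hx⟩
    rintro (_ | a) ha
    · rfl
    · exact h a (Finset.mem_eraseNone.2 ha)

theorem PosForm.exists_quantify_one {L : LocalLanguage} {α : Type} {σ : α → L.Sorts}
    [DecidableEq α] (φ : PosForm L α σ) (a : α) :
    ∃ ψ : PosForm L α σ, ∀ (M : LStructure L) (v : (a : α) → M.Dom (σ a)),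
      ψ.Realize M v ↔ ∃ x, φ.Realize M (Function.update v a x) := by
  refine ⟨.ex (σ a) (φ.subst (fun b =>
    if h : b = a then h ▸ LTerm.var (σ := osort (σ a) σ) none
    else LTerm.var (σ := osort (σ a) σ) (some b))), fun M v => exists_congr fun x => ?_⟩
  rw [PosForm.realize_subst]
  refine iff_of_eq (congrArg _ (funext fun b => ?_))
  by_cases h : b = a
  · subst h
    simp [LTerm.realize, vcons]
  · simp [h, LTerm.realize, vcons]

theorem PosForm.exists_quantify {L : LocalLanguage} {α : Type} {σ : α → L.Sorts}
    (φ : PosForm L α σ) (S : Finset α) :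
    ∃ ψ : PosForm L α σ, ∀ (M : LStructure L) (v : (a : α) → M.Dom (σ a)),
      ψ.Realize M v ↔ ∃ w, (∀ a ∉ S, w a = v a) ∧ φ.Realize M w := by
  classical
  induction S using Finset.induction_on with
  | empty =>
    refine ⟨φ, fun M v => ⟨fun h => ⟨v, fun _ _ => rfl, h⟩, ?_⟩⟩
    rintro ⟨w, hw, h⟩
    rwa [← funext fun a => hw a (by simp)]
  | insert a S _ ih =>
    obtain ⟨ψ, hψ⟩ := ih
    obtain ⟨θ, hθ⟩ := ψ.exists_quantify_one a
    refine ⟨θ, fun M v => ?_⟩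
    simp only [hθ, hψ]
    constructor
    · rintro ⟨x, w, hw, h⟩
      refine ⟨w, fun b hb => ?_, h⟩
      rw [Finset.mem_insert, not_or] at hb
      rw [hw b hb.2, Function.update_of_ne hb.1]
    · rintro ⟨w, hw, h⟩
      refine ⟨w a, w, fun b hb => ?_, h⟩
      by_cases hba : b = a
      · subst hba; simp
      · rw [Function.update_of_ne hba]
        exact hw b (by simp [hba, hb])

/-- If all sorts of the context carry constants, the existential closure of a positive
formula is a positive sentence, even when the context is infinite. -/
theorem PosForm.exists_closure {L : LocalLanguage} {α : Type} {σ : α → L.Sorts}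
    (c : (a : α) → L.Const (σ a)) (φ : PosForm L α σ) :
    ∃ ψ : PosSentence L, ∀ M : LStructure L, ψ.RealizedIn M ↔ ∃ v, φ.Realize M v := by
  classical
  obtain ⟨S, hS⟩ := φ.exists_finite_support
  obtain ⟨θ, hθ⟩ := φ.exists_quantify S
  refine ⟨θ.subst (fun a => .const (c a)), fun M => ?_⟩
  rw [PosSentence.RealizedIn, PosForm.realize_subst, hθ]
  constructor
  · rintro ⟨w, _, hw⟩
    exact ⟨w, hw⟩
  · rintro ⟨v, hv⟩
    refine ⟨fun a => if a ∈ S then v a else M.constMap (c a), fun a ha => by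
      simp [ha, LTerm.realize], hS M v _ (fun a ha => by simp [ha]) hv⟩

def LPosForm.toPos {L : LocalLanguage} :
    {α : Type} → {σ : α → L.Sorts} → LPosForm L α σ → PosForm L α σ
  | _, _, .rel R ts => .rel R ts
  | _, _, .and φ ψ => .and φ.toPos ψ.toPos
  | _, _, .or φ ψ => .or φ.toPos ψ.toPos
  | _, σ, .lex s d t φ => .ex s (.and (.rel (L.locToRel d)
      (tpair (LTerm.var (σ := osort s σ) none) (t.weaken s))) φ.toPos)

theorem LTerm.realize_tpair {L : LocalLanguage} (M : LStructure L) {α : Type}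
    {σ : α → L.Sorts} {s t : L.Sorts} (t₁ : LTerm L α σ s) (t₂ : LTerm L α σ t)
    (v : (a : α) → M.Dom (σ a)) :
    (fun i => (tpair t₁ t₂ i).realize M v) =
      dpair (C := fun i => M.Dom (![s, t] i)) (t₁.realize M v) (t₂.realize M v) := by
  funext i
  match i with
  | ⟨0, _⟩ => rfl
  | ⟨1, _⟩ => rfl

theorem LPosForm.realize_rel_tpair {L : LocalLanguage} (M : LStructure L) {α : Type}
    {σ : α → L.Sorts} {s : L.Sorts} (d : L.Loc s) (t₁ t₂ : LTerm L α σ s)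
    (v : (a : α) → M.Dom (σ a)) :
    LPosForm.Realize M (.rel (L.locToRel d) (tpair t₁ t₂)) v ↔
      M.locRel d (t₁.realize M v) (t₂.realize M v) :=
  iff_of_eq (congrArg (M.relMap (L.locToRel d)) (LTerm.realize_tpair M t₁ t₂ v))

theorem LPosForm.realize_toPos {L : LocalLanguage} (M : LStructure L) {α : Type}
    {σ : α → L.Sorts} (φ : LPosForm L α σ) :
    ∀ v : (a : α) → M.Dom (σ a), φ.toPos.Realize M v ↔ φ.Realize M v := by
  induction φ with
  | rel R ts => exact fun v => Iff.rfl
  | and φ ψ ih₁ ih₂ => exact fun v => and_congr (ih₁ v) (ih₂ v)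
  | or φ ψ ih₁ ih₂ => exact fun v => or_congr (ih₁ v) (ih₂ v)
  | lex s d t φ ih =>
    refine fun v => exists_congr fun x => and_congr ?_ (ih _)
    refine (LPosForm.realize_rel_tpair M d (LTerm.var (σ := osort s _) none) (t.weaken s)
      (vcons x v)).trans ?_
    rw [LTerm.realize_weaken]
    rfl

theorem exists_conj {L : LocalLanguage} {α : Type} {σ : α → L.Sorts}
    {Δ : Set (LPosForm L α σ)} (hΔ : Δ.Finite) :
    Δ = ∅ ∨ ∃ φ : PosForm L α σ, ∀ (M : LStructure L) (v : (a : α) → M.Dom (σ a)),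
      φ.Realize M v ↔ ∀ ψ ∈ Δ, LPosForm.Realize M ψ v := by
  induction Δ, hΔ using Set.Finite.induction_on with
  | empty => exact Or.inl rfl
  | @insert ψ Δ _ _ ih =>
    right
    rcases ih with rfl | ⟨φ, hφ⟩
    · exact ⟨ψ.toPos, fun M v => by simp [LPosForm.realize_toPos]⟩
    · exact ⟨.and ψ.toPos φ, fun M v => by
        simp [PosForm.Realize, LPosForm.realize_toPos, hφ]⟩

/-! ## Homomorphisms -/

theorem LHom.ext {L : LocalLanguage} {M N : LStructure L} {f g : LHom M N}
    (h : ∀ s x, f.toFun s x = g.toFun s x) : f = g := by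
  cases f
  cases g
  congr
  funext s x
  exact h s x

theorem LHom.map_locRel {L : LocalLanguage} {M N : LStructure L} (f : LHom M N)
    {s : L.Sorts} (d : L.Loc s) {a b : M.Dom s} (h : M.locRel d a b) :
    N.locRel d (f.toFun s a) (f.toFun s b) := by
  have := f.map_rel (L.locToRel d) _ h
  refine cast (congrArg (N.relMap (L.locToRel d)) (funext fun i => ?_)) this
  match i with
  | ⟨0, _⟩ => rfl
  | ⟨1, _⟩ => rfl

theorem LHom.realize_term {L : LocalLanguage} {M N : LStructure L} (f : LHom M N)
    {α : Type} {σ : α → L.Sorts} {s : L.Sorts} (t : LTerm L α σ s)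
    (v : (a : α) → M.Dom (σ a)) :
    t.realize N (fun a => f.toFun (σ a) (v a)) = f.toFun s (t.realize M v) := by
  cases t with
  | var a => rfl
  | const c => exact (f.map_const c).symm

theorem LHom.map_vcons {L : LocalLanguage} {M N : LStructure L} (f : LHom M N)
    {α : Type} {σ : α → L.Sorts} {s : L.Sorts} (x : M.Dom s) (v : (a : α) → M.Dom (σ a)) :
    (fun o => f.toFun (osort s σ o) (vcons x v o)) =
      vcons (f.toFun s x) (fun a => f.toFun (σ a) (v a)) := by
  funext o
  cases o <;> rfl

theorem LHom.realize_posForm {L : LocalLanguage} {M N : LStructure L} (f : LHom M N)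
    {α : Type} {σ : α → L.Sorts} (φ : PosForm L α σ) :
    ∀ v : (a : α) → M.Dom (σ a), φ.Realize M v →
      φ.Realize N (fun a => f.toFun (σ a) (v a)) := by
  induction φ with
  | rel R ts =>
    intro v h
    simpa only [PosForm.Realize, f.realize_term] using f.map_rel R _ h
  | and φ ψ ih₁ ih₂ => exact fun v h => ⟨ih₁ v h.1, ih₂ v h.2⟩
  | or φ ψ ih₁ ih₂ => exact fun v h => h.imp (ih₁ v) (ih₂ v)
  | ex s φ ih =>
    rintro v ⟨x, hx⟩
    exact ⟨f.toFun s x, f.map_vcons x v ▸ ih _ hx⟩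

theorem LHom.realize_lposForm {L : LocalLanguage} {M N : LStructure L} (f : LHom M N)
    {α : Type} {σ : α → L.Sorts} (φ : LPosForm L α σ) (v : (a : α) → M.Dom (σ a))
    (h : φ.Realize M v) : φ.Realize N (fun a => f.toFun (σ a) (v a)) :=
  (φ.realize_toPos N _).1 (f.realize_posForm _ _ ((φ.realize_toPos M v).2 h))

/-- The tuple enumerating all elements of a structure. -/
def LStructure.enum {L : LocalLanguage} (M : LStructure L) (p : Σ s : L.Sorts, M.Dom s) :
    M.Dom p.1 :=
  p.2

/-- A tuple realizing the local positive type of the enumeration of `M` is a homomorphism. -/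
def LHom.ofRealizes {L : LocalLanguage} {M N : LStructure L} (hM : IsLocal M) (hN : IsLocal N)
    (v : (p : Σ s : L.Sorts, M.Dom s) → N.Dom p.1)
    (hv : ∀ φ ∈ ltp M M.enum, φ.Realize N v) : LHom M N where
  toFun s x := v ⟨s, x⟩
  map_rel {_ ρ} R x h := hv
    (.rel R fun i => LTerm.var (σ := fun p : Σ s : L.Sorts, M.Dom s => p.1) ⟨ρ i, x i⟩) h
  map_const {s} c := by
    have := hv (.rel (L.locToRel (L.dd0 s)) (tpair
      (LTerm.var (σ := fun p : Σ s : L.Sorts, M.Dom s => p.1) ⟨s, M.constMap c⟩)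
      (LTerm.const c)))
      ((LPosForm.realize_rel_tpair M _ _ _ _).2 ((hM.dd0_eq _ _).2 rfl))
    exact (hN.dd0_eq _ _).1 ((LPosForm.realize_rel_tpair N _ _ _ _).1 this)

/-! ## Local ultrapowers -/

section Ultrapower

open Filter

variable {L : LocalLanguage} {I : Type}

/-- The component of the ultrapower `M ^ U` consisting of the elements at bounded distance
from the diagonal. -/
def LStructure.localUltrapower (M : LStructure L) (hM : IsLocal M) (U : Ultrafilter I) :
    LStructure L where
  Dom s := {x : Germ (U : Filter I) (M.Dom s) //
    ∃ (d : L.Loc s) (c : M.Dom s), ∀ᶠ i in (U : Filter I), M.locRel d (Quotient.out x i) c}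
  relMap R x := ∀ᶠ i in (U : Filter I), M.relMap R (fun k => Quotient.out (x k).1 i)
  constMap {s} c := ⟨((fun _ => M.constMap c : I → M.Dom s) : Germ (U : Filter I) (M.Dom s)), by
    obtain ⟨d, hd⟩ := hM.total (M.constMap c) (M.constMap c)
    refine ⟨d, M.constMap c, ?_⟩
    filter_upwards [Quotient.mk_out (s := germSetoid (U : Filter I) (M.Dom s))
      (fun _ => M.constMap c)] with i hi
    exact hi.symm ▸ hd⟩

namespace LStructure.localUltrapower

variable {M : LStructure L} {hM : IsLocal M} {U : Ultrafilter I}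

/-- The `i`-th coordinate of an element of the local ultrapower. -/
def coord {s : L.Sorts} (x : (M.localUltrapower hM U).Dom s) (i : I) : M.Dom s :=
  Quotient.out x.1 i

theorem relMap_iff {n : ℕ} {ρ : Fin n → L.Sorts} (R : L.Rel n ρ)
    (x : (k : Fin n) → (M.localUltrapower hM U).Dom (ρ k)) :
    (M.localUltrapower hM U).relMap R x ↔
      ∀ᶠ i in (U : Filter I), M.relMap R (fun k => coord (x k) i) :=
  Iff.rfl

theorem locRel_iff {s : L.Sorts} (d : L.Loc s) (x y : (M.localUltrapower hM U).Dom s) :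
    (M.localUltrapower hM U).locRel d x y ↔
      ∀ᶠ i in (U : Filter I), M.locRel d (coord x i) (coord y i) := by
  refine (relMap_iff _ _).trans (eventually_congr (Eventually.of_forall fun i => ?_))
  refine iff_of_eq (congrArg (M.relMap (L.locToRel d)) (funext fun k => ?_))
  match k with
  | ⟨0, _⟩ => rfl
  | ⟨1, _⟩ => rfl

theorem exists_coord {s : L.Sorts} (g : I → M.Dom s) (d : L.Loc s) (c : M.Dom s)
    (h : ∀ᶠ i in (U : Filter I), M.locRel d (g i) c) :
    ∃ x : (M.localUltrapower hM U).Dom s, ∀ᶠ i in (U : Filter I), coord x i = g i := by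
  have hg : ∀ᶠ i in (U : Filter I), (Quotient.out (g : Germ (U : Filter I) (M.Dom s))) i = g i :=
    Quotient.mk_out (s := germSetoid (U : Filter I) (M.Dom s)) g
  refine ⟨⟨(g : Germ (U : Filter I) (M.Dom s)), d, c, ?_⟩, hg⟩
  filter_upwards [hg, h] with i hi hd
  rwa [hi]

theorem ext_coord {s : L.Sorts} {x y : (M.localUltrapower hM U).Dom s}
    (h : ∀ᶠ i in (U : Filter I), coord x i = coord y i) : x = y := by
  refine Subtype.ext ?_
  rw [← Quotient.out_eq x.1, ← Quotient.out_eq y.1]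
  exact Quotient.sound h

theorem coord_const {s : L.Sorts} (c : L.Const s) :
    ∀ᶠ i in (U : Filter I),
      coord ((M.localUltrapower hM U).constMap c) i = M.constMap c :=
  Quotient.mk_out (s := germSetoid (U : Filter I) (M.Dom s)) fun _ => M.constMap c

theorem coord_near {s : L.Sorts} (x : (M.localUltrapower hM U).Dom s) :
    ∃ (d : L.Loc s) (c : M.Dom s), ∀ᶠ i in (U : Filter I), M.locRel d (coord x i) c :=
  x.2

theorem isLocal : IsLocal (M.localUltrapower hM U) where
  symm d a b h := by
    rw [locRel_iff] at h ⊢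
    exact h.mono fun i => hM.symm _ _ _
  mono d₁ d₂ hd a b h := by
    rw [locRel_iff] at h ⊢
    exact h.mono fun i => hM.mono _ _ hd _ _
  comp d₁ d₂ a b c h₁ h₂ := by
    rw [locRel_iff] at h₁ h₂ ⊢
    filter_upwards [h₁, h₂] with i h₁ h₂ using hM.comp _ _ _ _ _ h₁ h₂
  boundAx c₁ c₂ := by
    rw [locRel_iff]
    filter_upwards [coord_const c₁, coord_const c₂] with i h₁ h₂
    rw [h₁, h₂]
    exact hM.boundAx c₁ c₂
  total a b := by
    obtain ⟨d₁, c₁, h₁⟩ := coord_near a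
    obtain ⟨d₂, c₂, h₂⟩ := coord_near b
    obtain ⟨d, hd⟩ := hM.total c₁ c₂
    refine ⟨L.locMul d₁ (L.locMul d d₂), (locRel_iff _ _ _).2 ?_⟩
    filter_upwards [h₁, h₂] with i h₁ h₂
    exact hM.comp _ _ _ _ _ h₁ (hM.comp _ _ _ _ _ hd (hM.symm _ _ _ h₂))
  dd0_eq a b := by
    simp only [locRel_iff, hM.dd0_eq]
    exact ⟨ext_coord, fun h => h ▸ Eventually.of_forall fun _ => rfl⟩

/-- A tuple of elements is represented by a family of tuples of `M`. -/
def Represents {α : Type} {σ : α → L.Sorts} (w : I → (a : α) → M.Dom (σ a))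
    (v : (a : α) → (M.localUltrapower hM U).Dom (σ a)) : Prop :=
  ∀ a, ∀ᶠ i in (U : Filter I), coord (v a) i = w i a

theorem Represents.vcons {α : Type} {σ : α → L.Sorts} {w : I → (a : α) → M.Dom (σ a)}
    {v : (a : α) → (M.localUltrapower hM U).Dom (σ a)} (h : Represents w v) {s : L.Sorts}
    {g : I → M.Dom s} {x : (M.localUltrapower hM U).Dom s}
    (hx : ∀ᶠ i in (U : Filter I), coord x i = g i) :
    Represents (fun i => vcons (g i) (w i)) (_root_.vcons x v) := by
  rintro (_ | a)
  · exact hx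
  · exact h a

theorem Represents.term {α : Type} {σ : α → L.Sorts} {w : I → (a : α) → M.Dom (σ a)}
    {v : (a : α) → (M.localUltrapower hM U).Dom (σ a)} (h : Represents w v) {s : L.Sorts}
    (t : LTerm L α σ s) :
    ∀ᶠ i in (U : Filter I), coord (t.realize _ v) i = t.realize M (w i) := by
  cases t with
  | var a => exact h a
  | const c => exact coord_const c

theorem Represents.realize_rel {α : Type} {σ : α → L.Sorts} {w : I → (a : α) → M.Dom (σ a)}
    {v : (a : α) → (M.localUltrapower hM U).Dom (σ a)} (h : Represents w v)
    {n : ℕ} {ρ : Fin n → L.Sorts} (R : L.Rel n ρ) (ts : (i : Fin n) → LTerm L α σ (ρ i)) :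
    (M.localUltrapower hM U).relMap R (fun k => (ts k).realize _ v) ↔
      ∀ᶠ i in (U : Filter I), M.relMap R (fun k => (ts k).realize M (w i)) := by
  rw [relMap_iff]
  refine eventually_congr ?_
  filter_upwards [eventually_all.2 fun k => h.term (ts k)] with i hi
  rw [funext hi]

theorem Represents.eventually_realize {α : Type} {σ : α → L.Sorts} (φ : PosForm L α σ) :
    ∀ {w : I → (a : α) → M.Dom (σ a)} {v : (a : α) → (M.localUltrapower hM U).Dom (σ a)},
      Represents w v → φ.Realize _ v → ∀ᶠ i in (U : Filter I), φ.Realize M (w i) := by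
  induction φ with
  | rel R ts => exact fun h hv => (h.realize_rel R ts).1 hv
  | and φ ψ ih₁ ih₂ =>
    intro w v h hv
    filter_upwards [ih₁ h hv.1, ih₂ h hv.2] with i h₁ h₂ using ⟨h₁, h₂⟩
  | or φ ψ ih₁ ih₂ =>
    rintro w v h (hv | hv)
    · exact (ih₁ h hv).mono fun i => Or.inl
    · exact (ih₂ h hv).mono fun i => Or.inr
  | ex s φ ih =>
    rintro w v h ⟨x, hx⟩
    exact (ih (h.vcons (g := coord x) (Eventually.of_forall fun _ => rfl)) hx).mono
      fun i hi => ⟨_, hi⟩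

theorem Represents.realize {α : Type} {σ : α → L.Sorts} (φ : LPosForm L α σ) :
    ∀ {w : I → (a : α) → M.Dom (σ a)} {v : (a : α) → (M.localUltrapower hM U).Dom (σ a)},
      Represents w v → (∀ᶠ i in (U : Filter I), φ.Realize M (w i)) → φ.Realize _ v := by
  classical
  induction φ with
  | rel R ts => exact fun h hv => (h.realize_rel R ts).2 hv
  | and φ ψ ih₁ ih₂ =>
    exact fun h hv => ⟨ih₁ h (hv.mono fun i => And.left), ih₂ h (hv.mono fun i => And.right)⟩
  | or φ ψ ih₁ ih₂ =>
    exact fun h hv => (Ultrafilter.eventually_or.1 hv).imp (ih₁ h) (ih₂ h)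
  | lex s d t φ ih =>
    intro w v h hv
    obtain ⟨e, c, hc⟩ := coord_near (t.realize _ v)
    let g : I → M.Dom s := fun i =>
      if hi : LPosForm.Realize M (.lex s d t φ) (w i) then hi.choose else c
    have hg : ∀ᶠ i in (U : Filter I),
        M.locRel d (g i) (t.realize M (w i)) ∧ φ.Realize M (_root_.vcons (g i) (w i)) := by
      filter_upwards [hv] with i hi
      simp only [g, dif_pos hi]
      exact hi.choose_spec
    obtain ⟨x, hx⟩ := exists_coord (hM := hM) g (L.locMul d e) c (by
      filter_upwards [hg, hc, h.term t] with i hi hc ht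
      exact hM.comp _ _ _ _ _ hi.1 (ht ▸ hc))
    refine ⟨x, (locRel_iff _ _ _).2 ?_, ih (h.vcons hx) (hg.mono fun i => And.right)⟩
    filter_upwards [hg, hx, h.term t] with i hi hx ht
    rw [hx, ht]
    exact hi.1

theorem localModel_thNeg : LocalModel (M.localUltrapower hM U) (ThNeg M) := by
  refine ⟨isLocal, fun φ hφ h => hφ ?_⟩
  obtain ⟨i, hi⟩ := (Represents.eventually_realize φ
    (w := fun _ e => e.elim) (fun e => e.elim) h).exists
  exact hi

/-- The diagonal homomorphism. -/
theorem exists_diagonal : ∃ δ : LHom M (M.localUltrapower hM U),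
    ∀ s x, ∀ᶠ i in (U : Filter I), coord (δ.toFun s x) i = x := by
  have : ∀ s (x : M.Dom s), ∃ y : (M.localUltrapower hM U).Dom s,
      ∀ᶠ i in (U : Filter I), coord y i = x := fun s x => by
    obtain ⟨d, hd⟩ := hM.total x x
    exact exists_coord (fun _ => x) d x (Eventually.of_forall fun _ => hd)
  choose δ hδ using this
  refine ⟨⟨δ, fun R x h => ?_, fun c => ext_coord ?_⟩, hδ⟩
  · rw [relMap_iff]
    filter_upwards [eventually_all.2 fun k => hδ _ (x k)] with i hi
    rwa [funext hi]
  · filter_upwards [hδ _ (M.constMap c), coord_const (hM := hM) c] with i h₁ h₂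
    rw [h₁, h₂]

end LStructure.localUltrapower

/-- Every variable is bounded by a formula of the set. -/
def BoundsVars {α : Type} {σ : α → L.Sorts} (Γ : Set (LPosForm L α σ)) : Prop :=
  ∀ a, ∃ (d : L.Loc (σ a)) (c : L.Const (σ a)),
    LPosForm.rel (L.locToRel d) (tpair (LTerm.var a) (LTerm.const c)) ∈ Γ

theorem BoundsVars.exists_realizes {M : LStructure L} (hM : IsLocal M) (U : Ultrafilter I)
    {α : Type} {σ : α → L.Sorts} {Γ : Set (LPosForm L α σ)} (hb : BoundsVars Γ)
    (w : I → (a : α) → M.Dom (σ a))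
    (hw : ∀ φ ∈ Γ, ∀ᶠ i in (U : Filter I), LPosForm.Realize M φ (w i)) :
    ∃ v : (a : α) → (M.localUltrapower hM U).Dom (σ a),
      ∀ φ ∈ Γ, LPosForm.Realize _ φ v := by
  have : ∀ a, ∃ x : (M.localUltrapower hM U).Dom (σ a),
      ∀ᶠ i in (U : Filter I), LStructure.localUltrapower.coord x i = w i a := fun a => by
    obtain ⟨d, c, h⟩ := hb a
    exact LStructure.localUltrapower.exists_coord _ d (M.constMap c) ((hw _ h).mono fun i hi =>
      (LPosForm.realize_rel_tpair M _ _ _ _).1 hi)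
  choose v hv using this
  exact ⟨v, fun φ hφ => LStructure.localUltrapower.Represents.realize φ hv (hw φ hφ)⟩

/-- Finite satisfiability of a set of local positive formulas in a structure. -/
def FinSatIn (M : LStructure L) {α : Type} {σ : α → L.Sorts}
    (Γ : Set (LPosForm L α σ)) : Prop :=
  ∀ Δ ⊆ Γ, Δ.Finite → ∃ v, ∀ φ ∈ Δ, LPosForm.Realize M φ v

theorem FinSatIn.exists_filter {M : LStructure L} {α : Type} {σ : α → L.Sorts}
    {Γ : Set (LPosForm L α σ)} (h : FinSatIn M Γ) :
    ∃ F : Filter ((a : α) → M.Dom (σ a)), F.NeBot ∧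
      ∀ φ ∈ Γ, ∀ᶠ v in F, LPosForm.Realize M φ v := by
  refine ⟨generate ((fun φ => {v | LPosForm.Realize M φ v}) '' Γ),
    generate_neBot_iff.2 fun t ht hf => ?_,
    fun φ hφ => mem_generate_of_mem ⟨φ, hφ, rfl⟩⟩
  obtain ⟨Δ, hΔ, hfΔ, rfl⟩ := (Set.exists_subset_image_finite_and
    (p := fun u => u = t)).1 ⟨t, ht, hf, rfl⟩
  obtain ⟨v, hv⟩ := h Δ hΔ hfΔ
  exact ⟨v, by rintro _ ⟨φ, hφ, rfl⟩; exact hv φ hφ⟩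

end Ultrapower

theorem LocalModel.nonempty_of_thNeg {L : LocalLanguage} {M P : LStructure L}
    (hP : LocalModel P (ThNeg M)) {s : L.Sorts} (x : P.Dom s) : Nonempty (M.Dom s) := by
  let t : LTerm L (Option Empty) (osort s (emptySorts L)) s :=
    LTerm.var (σ := osort s (emptySorts L)) none
  by_contra h
  refine hP.2 (.ex s (.rel (L.locToRel (L.dd0 s)) (tpair t t))) (fun ⟨y, _⟩ => h ⟨y⟩) ⟨x, ?_⟩
  exact (LPosForm.realize_rel_tpair P (L.dd0 s) t t (vcons x _)).2 ((hP.1.dd0_eq x x).2 rfl)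

/-! ## Expansions by parameters -/

section Params

variable {L : LocalLanguage}

/-- The reduct to `L` of an `L(A)`-structure. -/
def paramReduct {M : LStructure L} {hM : IsLocal M} {A : ParamSet M}
    (N : LStructure (L.withParams M hM A)) : LStructure L where
  Dom := N.Dom
  relMap := N.relMap
  constMap c := N.constMap (.inl c)

def LHom.reduct {M : LStructure L} {hM : IsLocal M} {A : ParamSet M}
    {N P : LStructure (L.withParams M hM A)} (f : LHom N P) : LHom (paramReduct N) (paramReduct P) where
  toFun := f.toFun
  map_rel := f.map_rel
  map_const c := f.map_const (.inl c)

/-- The expansion to `L(A)` of the codomain of a homomorphism defined on `M`. -/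
def LHom.expand {M N : LStructure L} (f : LHom M N) (hM : IsLocal M) (A : ParamSet M) :
    LStructure (L.withParams M hM A) where
  Dom := N.Dom
  relMap := N.relMap
  constMap {s} c := match c with
    | .inl c => N.constMap c
    | .inr a => f.toFun s a.1

variable {M : LStructure L} {hM : IsLocal M} {A : ParamSet M}

theorem isLocal_paramReduct {N : LStructure (L.withParams M hM A)} (h : IsLocal N) :
    IsLocal (paramReduct N) where
  symm := h.symm
  mono := h.mono
  comp := h.comp
  boundAx c₁ c₂ := h.boundAx (s := _) (.inl c₁) (.inl c₂)
  total := h.total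
  dd0_eq := h.dd0_eq

theorem LHom.isLocal_expand {N : LStructure L} (f : LHom M N) (hN : IsLocal N) :
    IsLocal (f.expand hM A) where
  symm := hN.symm
  mono := hN.mono
  comp := hN.comp
  boundAx := by
    rintro s (c₁ | a) (c₂ | b)
    · exact hN.boundAx c₁ c₂
    · have := f.map_locRel _ (Classical.choose_spec (hM.total
        (paramInterp M A (.inl c₁)) (paramInterp M A (.inr b))))
      rw [show f.toFun s (paramInterp M A (.inl c₁)) = N.constMap c₁ from f.map_const c₁] at this
      exact this
    · have := f.map_locRel _ (Classical.choose_spec (hM.total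
        (paramInterp M A (.inr a)) (paramInterp M A (.inl c₂))))
      rw [show f.toFun s (paramInterp M A (.inl c₂)) = N.constMap c₂ from f.map_const c₂] at this
      exact this
    · exact f.map_locRel _ (Classical.choose_spec (hM.total
        (paramInterp M A (.inr a)) (paramInterp M A (.inr b))))
  total := hN.total
  dd0_eq := hN.dd0_eq

theorem LHom.expand_id : (LHom.id M).expand hM A = M.withParams hM A := by
  unfold LHom.expand LStructure.withParams
  congr
  funext s c
  cases c <;> rfl

theorem IsLocal.withParams (hM : IsLocal M) (A : ParamSet M) : IsLocal (M.withParams hM A) :=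
  LHom.expand_id (hM := hM) (A := A) ▸ (LHom.id M).isLocal_expand hM

/-- A positive sentence of `L`, as a sentence of `L(A)`. -/
theorem PosForm.exists_lift (hM : IsLocal M) (A : ParamSet M) (φ : PosSentence L) :
    ∃ ψ : PosSentence (L.withParams M hM A), ∀ N : LStructure (L.withParams M hM A),
      ψ.RealizedIn N ↔ φ.RealizedIn (paramReduct N) := by
  refine ⟨PosForm.translate (L := L) (L' := L.withParams M hM A) (fun s => s) (fun R => R) φ
    (fun e => e.elim) (fun s c => .const (.inl c)), fun N => ?_⟩
  refine (PosForm.realize_translate (L := L) (L' := L.withParams M hM A) (fun s => s)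
    (fun R => R) N (fun c => N.constMap (.inl c)) φ _ _ _ (fun _ _ => rfl)).trans ?_
  refine iff_of_eq (congrArg _ (funext fun e => e.elim))

/-- A positive sentence of `L(A)`, as a positive formula of `L` with variables for the
elements of `M`. -/
theorem PosForm.exists_unparam (hM : IsLocal M) (A : ParamSet M)
    (φ : PosSentence (L.withParams M hM A)) :
    ∃ ψ : PosForm L (Σ s : L.Sorts, M.Dom s) (fun p => p.1),
      ∀ (N : LStructure L) (f : LHom M N),
        ψ.Realize N (fun p => f.toFun p.1 p.2) ↔ φ.RealizedIn (f.expand hM A) := by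
  refine ⟨PosForm.translate (L := L.withParams M hM A) (L' := L) (fun s => s) (fun R => R) φ
    (fun e => e.elim) (fun s c => match c with
      | .inl c => .const c
      | .inr a => LTerm.var (σ := fun p : Σ s : L.Sorts, M.Dom s => p.1) ⟨s, a.1⟩),
    fun N f => ?_⟩
  refine (PosForm.realize_translate (L := L.withParams M hM A) (L' := L) (fun s => s)
    (fun R => R) N (f.expand hM A).constMap φ _ _ _ ?_).trans ?_
  · rintro s (c | a) <;> rfl
  · exact iff_of_eq (congrArg _ (funext fun e => e.elim))

theorem LocalModel.reduct {T : Set (PosSentence L)} {N P : LStructure (L.withParams M hM A)}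
    (hN : LocalModel N (ThNeg P)) (hP : LocalModel (paramReduct P) T) : LocalModel (paramReduct N) T := by
  refine ⟨isLocal_paramReduct hN.1, fun φ hφ h => ?_⟩
  obtain ⟨ψ, hψ⟩ := φ.exists_lift hM A
  exact hN.2 ψ (fun h' => hP.2 φ hφ ((hψ P).1 h')) ((hψ N).2 h)

theorem LHom.IsPosEmbedding.localModel_expand {N : LStructure L} {f : LHom M N}
    (hf : f.IsPosEmbedding) (hN : IsLocal N) :
    LocalModel (f.expand hM A) (ThNeg (M.withParams hM A)) := by
  refine ⟨f.isLocal_expand hN, fun φ hφ h => hφ ?_⟩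
  obtain ⟨ψ, hψ⟩ := PosForm.exists_unparam hM A φ
  rw [← LHom.expand_id]
  exact (hψ M (LHom.id M)).1 (hf _ _ ψ _ ((hψ N f).2 h))

/-- All elements of `M`, as parameters. -/
def ParamSet.full (M : LStructure L) : ParamSet M := fun _ => Set.univ

variable {P : LStructure (L.withParams M hM (ParamSet.full M))}

theorem LocalModel.finSatIn_of_full
    (hP : LocalModel P (ThNeg (M.withParams hM (ParamSet.full M)))) {α : Type}
    {σ : α → L.Sorts} (w : (a : α) → P.Dom (σ a))
    {Γ : Set (LPosForm (L.withParams M hM (ParamSet.full M)) α σ)}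
    (hw : ∀ φ ∈ Γ, LPosForm.Realize P φ w) :
    FinSatIn (M.withParams hM (ParamSet.full M)) Γ := by
  intro Δ hΔ hf
  have c := fun a => (hP.nonempty_of_thNeg (w a)).some
  rcases exists_conj hf with rfl | ⟨φ, hφ⟩
  · exact ⟨c, by simp⟩
  · obtain ⟨ψ, hψ⟩ := φ.exists_closure fun a => Sum.inr ⟨c a, trivial⟩
    have : ψ.RealizedIn (M.withParams hM (ParamSet.full M)) := by
      by_contra h
      exact hP.2 ψ h ((hψ P).2 ⟨w, (hφ P w).2 fun θ hθ => hw θ (hΔ hθ)⟩)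
    obtain ⟨v, hv⟩ := (hψ _).1 this
    exact ⟨v, (hφ _ v).1 hv⟩

theorem LocalModel.boundsVars_of_full
    (hP : LocalModel P (ThNeg (M.withParams hM (ParamSet.full M)))) :
    BoundsVars (ltp P P.enum) := by
  intro p
  obtain ⟨c⟩ := hP.nonempty_of_thNeg p.2
  obtain ⟨d, hd⟩ := hP.1.total p.2 (P.constMap (Sum.inr ⟨c, trivial⟩))
  exact ⟨d, Sum.inr ⟨c, trivial⟩, (LPosForm.realize_rel_tpair P _ _ _ _).2 hd⟩

theorem hasLJPOver_full (hM : IsLocal M) : HasLJPOver M hM (ParamSet.full M) := by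
  intro P Q hP hQ
  obtain ⟨F, hF, hFP⟩ := (hP.finSatIn_of_full P.enum fun φ h => h).exists_filter
  obtain ⟨G, hG, hGQ⟩ := (hQ.finSatIn_of_full Q.enum fun φ h => h).exists_filter
  have hloc := hM.withParams (ParamSet.full M)
  let U := Ultrafilter.of (F ×ˢ G)
  have hU : (U : Filter _) ≤ F ×ˢ G := Ultrafilter.of_le _
  obtain ⟨v, hv⟩ := hP.boundsVars_of_full.exists_realizes hloc U Prod.fst
    fun φ hφ => hU (Filter.tendsto_fst (hFP φ hφ))
  obtain ⟨w, hw⟩ := hQ.boundsVars_of_full.exists_realizes hloc U Prod.snd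
    fun φ hφ => hU (Filter.tendsto_snd (hGQ φ hφ))
  exact ⟨_, LStructure.localUltrapower.localModel_thNeg (hM := hloc) (U := U),
    ⟨LHom.ofRealizes hP.1 LStructure.localUltrapower.isLocal v hv⟩,
    ⟨LHom.ofRealizes hQ.1 LStructure.localUltrapower.isLocal w hw⟩⟩

/-- Over the full parameter set, every partial local positive type bounding its variables
extends to a local positive type. -/
theorem BoundsVars.exists_isLType (hM : IsLocal M) {α : Type} {σ : α → L.Sorts}
    {Γ : Set (LPosForm (L.withParams M hM (ParamSet.full M)) α σ)} (hb : BoundsVars Γ)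
    (h : FinSatIn (M.withParams hM (ParamSet.full M)) Γ) :
    ∃ Γ', Γ ⊆ Γ' ∧ IsLType (ThNeg (M.withParams hM (ParamSet.full M))) Γ' := by
  obtain ⟨Γ', hΓ, hmax⟩ := zorn_subset_nonempty
    {Δ | FinSatIn (M.withParams hM (ParamSet.full M)) (σ := σ) Δ} (by
      refine fun c hc hchain hne => ⟨⋃₀ c, fun Δ hΔ hf => ?_, fun s => Set.subset_sUnion_of_mem⟩
      obtain ⟨t, ht, hΔt⟩ := hchain.directedOn.exists_mem_subset_of_finite_of_subset_sUnion
        hne hf hΔ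
      exact hc ht Δ hΔt hf) Γ h
  refine ⟨Γ', hΓ, ?_, ?_⟩
  · obtain ⟨F, hF, hFΓ⟩ := FinSatIn.exists_filter hmax.prop
    have hloc := hM.withParams (ParamSet.full M)
    have hb' : BoundsVars Γ' := fun a => by
      obtain ⟨d, c, hdc⟩ := hb a
      exact ⟨d, c, hΓ hdc⟩
    obtain ⟨v, hv⟩ := hb'.exists_realizes hloc (Ultrafilter.of F) (fun v => v)
      fun φ hφ => Ultrafilter.of_le F (hFΓ φ hφ)
    exact ⟨_, v, LStructure.localUltrapower.localModel_thNeg, hv⟩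
  · rintro Δ ⟨N, v, hN, hv⟩ hsub
    exact (hmax.eq_of_subset (hN.finSatIn_of_full v hv) hsub).symm

end Params

/-! ## Retractors -/

section Retractors

variable {L : LocalLanguage} {T : Set (PosSentence L)} {C : LStructure L}

theorem IsRetractor.of_ultrahomogeneous (hC : LocalModel C T)
    (h : ∀ κ : Cardinal, IsUltrahomogeneous T C κ) : IsRetractor T C := by
  refine ⟨hC, fun N hN f => ?_⟩
  exact h (Order.succ (max C.card N.card)) C N hC hN
    (Order.lt_succ_of_le (le_max_left _ _)) (Order.lt_succ_of_le (le_max_right _ _))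
    (LHom.id C) (fun _ _ _ _ h => h) f

theorem IsRetractor.ultrahomogeneous (h : IsRetractor T C) (κ : Cardinal) :
    IsUltrahomogeneous T C κ := by
  intro A B hA hB _ _ f hf g
  have hCA := hf.localModel_expand (hM := hA.1) (A := ParamSet.full A) h.1.1
  have hBA := g.isLocal_expand (hM := hA.1) (A := ParamSet.full A) hB.1
  obtain ⟨F, hF, hFC⟩ := (hCA.finSatIn_of_full _ fun φ h => h).exists_filter
  let gA : LHom (A.withParams hA.1 (ParamSet.full A)) (g.expand hA.1 (ParamSet.full A)) :=
    ⟨g.toFun, g.map_rel, by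
      rintro s (c | a)
      · exact g.map_const c
      · rfl⟩
  obtain ⟨v, hv⟩ := hCA.boundsVars_of_full.exists_realizes hBA (Ultrafilter.of F)
    (fun w p => gA.toFun _ (w p)) fun φ hφ =>
      Filter.Eventually.mono (Ultrafilter.of_le F (hFC φ hφ)) fun w hw => gA.realize_lposForm φ w hw
  let j := LHom.ofRealizes hCA.1 LStructure.localUltrapower.isLocal v hv
  obtain ⟨δ, hδ⟩ := LStructure.localUltrapower.exists_diagonal (hM := hBA)
    (U := Ultrafilter.of F)
  obtain ⟨r, hr⟩ := h.2 _ (LocalModel.reduct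
    (LStructure.localUltrapower.localModel_thNeg (hM := hBA) (U := Ultrafilter.of F)) hB) j.reduct
  refine ⟨r.comp δ.reduct, LHom.ext fun s a => ?_⟩
  have h₁ : δ.toFun s (g.toFun s a) = j.toFun s (f.toFun s a) :=
    (δ.map_const (Sum.inr ⟨a, trivial⟩)).trans (j.map_const (Sum.inr ⟨a, trivial⟩)).symm
  have h₂ : r.toFun s (j.toFun s (f.toFun s a)) = f.toFun s a :=
    congrFun (congrFun (congrArg LHom.toFun hr) s) (f.toFun s a)
  exact (congrArg (r.toFun s) h₁).trans h₂

theorem IsRetractor.isPC (h : IsRetractor T C) : IsPC C T := by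
  refine ⟨h.1, fun N f hN α σ φ v hv => ?_⟩
  obtain ⟨g, hg⟩ := h.2 N hN f
  have := g.realize_posForm φ _ hv
  have e : ∀ a, g.toFun (σ a) (f.toFun (σ a) (v a)) = v a := fun a =>
    congrFun (congrFun (congrArg LHom.toFun hg) (σ a)) (v a)
  simpa only [e] using this

theorem IsRetractor.saturated (h : IsRetractor T C) (κ : Cardinal) :
    IsSaturatedAt C h.1.1 κ := by
  rintro A - hA α σ - Γ ⟨⟨M, w, hM, hw⟩, -⟩
  obtain ⟨N, hN, ⟨f⟩, ⟨g⟩⟩ := hA (C.withParams h.1.1 A) M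
    ⟨h.1.1.withParams A, fun φ hφ => hφ⟩ hM
  obtain ⟨r, hr⟩ := h.2 (paramReduct N) (LocalModel.reduct hN h.1) f.reduct
  have e : ∀ s x, r.toFun s (f.toFun s x) = x := fun s x =>
    congrFun (congrFun (congrArg LHom.toFun hr) s) x
  let rA : LHom N (C.withParams h.1.1 A) :=
    ⟨r.toFun, r.map_rel, fun c => by rw [← f.map_const]; exact e _ _⟩
  exact ⟨_, fun φ hφ => (rA.comp g).realize_lposForm φ w (hw φ hφ)⟩

theorem IsRetractor.of_saturated (hC : IsPC C T)
    (h : ∀ κ : Cardinal, IsSaturatedAt C hC.1.1 κ) : IsRetractor T C := by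
  refine ⟨hC.1, fun N hN f => ?_⟩
  have hNC := (hC.2 N f hN).localModel_expand (hM := hC.1.1) (A := ParamSet.full C) hN.1
  obtain ⟨Γ, hsub, hΓ⟩ := hNC.boundsVars_of_full.exists_isLType hC.1.1
    (hNC.finSatIn_of_full _ fun φ h => h)
  obtain ⟨v, hv⟩ := h (Order.succ (max (Cardinal.mk (Σ s : L.Sorts, ParamSet.full C s))
      (Cardinal.mk (Σ s : L.Sorts, N.Dom s)))) (ParamSet.full C)
    (Order.lt_succ_of_le (le_max_left _ _)) (hasLJPOver_full hC.1.1) _ _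
    (Order.lt_succ_of_le (le_max_right _ _)) Γ hΓ
  let g := LHom.ofRealizes hNC.1 (hC.1.1.withParams _) v fun φ hφ => hv φ (hsub hφ)
  exact ⟨g.reduct, LHom.ext fun s c => g.map_const (Sum.inr ⟨c, trivial⟩)⟩

end Retractors

/-- For a local model `C` of `T`, the following are equivalent:
(i) `C` is an absolutely ultrahomogeneous model of `T`; (ii) `C` is a retractor of `T`;
(iii) `C` is an absolutely saturated local positively closed model of `T`. -/
theorem retractor_characterizations
    {L : LocalLanguage} (T : Set (PosSentence L))
    (hT : IsNegLocalTheory T) (hsat : LocSat T)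
    (C : LStructure L) (hC : LocalModel C T) :
    ((∀ κ : Cardinal, IsUltrahomogeneous T C κ) ↔ IsRetractor T C) ∧
    (IsRetractor T C ↔ (IsPC C T ∧ ∀ κ : Cardinal, IsSaturatedAt C hC.1 κ)) :=
  ⟨⟨IsRetractor.of_ultrahomogeneous hC, IsRetractor.ultrahomogeneous⟩,
    fun h => ⟨h.isPC, h.saturated⟩, fun h => IsRetractor.of_saturated h.1 h.2⟩
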